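/- Let K be an algebraically closed field and R = K[t, t^{-1}]. Let g : R^c → R^b and f : R^b → R^a be R-linear maps given by matrices over R with f ∘ g = 0, and let H = ker(f)/im(g) be the homology module. For each positive integer N let R_N = R/(t^N − 1) and let g_N : R_N^c → R_N^b and f_N : R_N^b → R_N^a be the induced maps, with homology H_N = ker(f_N)/im(g_N), a finite-dimensional K-vector space. Then the limit of dim_K(H_N)/N as N → ∞ exists and equals the rank of H over R, i.e., equals dim_{K(t)}(H ⊗_R K(t)). -/

import Mathlib

set_option synthInstance.maxHeartbeats 1000000
set_option maxHeartbeats 2000000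

open TensorProduct

/-- The ideal `(t^N - 1)` of the Laurent polynomial ring `R = K[t,t⁻¹]`, so that
`R_N = R ⧸ (t^N - 1)` is an `N`-dimensional `K`-algebra. -/
noncomputable def tIdeal (K : Type) [Field K] (N : ℕ) : Ideal (LaurentPolynomial K) :=
  Ideal.span {(LaurentPolynomial.T 1 : LaurentPolynomial K) ^ N - 1}

/-- The homology module `H = ker f / im g` of `R^c --g--> R^b --f--> R^a`, where
`f, g` are given by matrices `F, G` over `R = K[t,t⁻¹]`. -/
abbrev laurentHomology {K : Type} [Field K] {a b c : ℕ}
    (F : Matrix (Fin a) (Fin b) (LaurentPolynomial K))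
    (G : Matrix (Fin b) (Fin c) (LaurentPolynomial K)) :=
  LinearMap.ker F.mulVecLin ⧸
    (LinearMap.range G.mulVecLin).comap (LinearMap.ker F.mulVecLin).subtype

/-- The homology `H_N = ker f_N / im g_N` of the complex
`R_N^c → R_N^b → R_N^a` induced over `R_N = R ⧸ (t^N - 1)`, viewed as a
`K`-vector space. -/
abbrev laurentHomologyModN {K : Type} [Field K] {a b c : ℕ} (N : ℕ)
    (F : Matrix (Fin a) (Fin b) (LaurentPolynomial K))
    (G : Matrix (Fin b) (Fin c) (LaurentPolynomial K)) :=
  LinearMap.ker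
      ((Matrix.mulVecLin (F.map (Ideal.Quotient.mk (tIdeal K N)))).restrictScalars K) ⧸
    (LinearMap.range
        ((Matrix.mulVecLin (G.map (Ideal.Quotient.mk (tIdeal K N)))).restrictScalars K)).comap
      (LinearMap.ker
        ((Matrix.mulVecLin (F.map (Ideal.Quotient.mk (tIdeal K N)))).restrictScalars K)).subtype


section Finiteness

variable {K : Type} [Field K]

open LaurentPolynomial

theorem finite_quotient_span_singleton {d : LaurentPolynomial K} (hd : d ≠ 0) :
    Module.Finite K (LaurentPolynomial K ⧸ Ideal.span {d}) := by
  let π : LaurentPolynomial K →ₐ[K] LaurentPolynomial K ⧸ Ideal.span {d} :=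
    Ideal.Quotient.mkₐ K (Ideal.span {d})
  let : Invertible (π (T 1)) :=
    ⟨π (T (-1)), by rw [← map_mul, ← T_add]; simp, by rw [← map_mul, ← T_add]; simp⟩
  obtain ⟨n, p, hp⟩ := d.exists_T_pow
  have hx : IsAlgebraic K (π (T 1)) := by
    refine ⟨p, ?_, ?_⟩
    · rintro rfl
      have : d * T n * T (-n) = 0 := by rw [← hp]; simp
      rw [mul_assoc, ← T_add] at this
      simp [hd] at this
    · have h : Polynomial.aeval (π (T 1)) p = π (Polynomial.toLaurent p) := by
        rw [Polynomial.aeval_algHom_apply]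
        congr 1
        rw [← Polynomial.toLaurentAlg_apply]
        conv_rhs => rw [← Polynomial.aeval_X_left_apply p]
        rw [← Polynomial.aeval_algHom_apply]
        simp
      rw [h, hp]
      exact Ideal.Quotient.eq_zero_iff_mem.2 (Ideal.mul_mem_right _ _ (Ideal.mem_span_singleton_self d))
  have hy : IsAlgebraic K (⅟(π (T 1))) := hx.invOf
  have hfin := Algebra.finite_adjoin_of_finite_of_isIntegral (R := K)
    (s := {π (T 1), ⅟(π (T 1))}) (by simp) (by
      rintro y (rfl | rfl)
      · exact hx.isIntegral
      · exact hy.isIntegral)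
  have htop : Algebra.adjoin K {π (T 1), ⅟(π (T 1))} = ⊤ := by
    rw [eq_top_iff]
    rintro y -
    obtain ⟨q, rfl⟩ := Ideal.Quotient.mkₐ_surjective K _ y
    change π q ∈ _
    have h1 : π (T 1) ∈ Algebra.adjoin K {π (T 1), ⅟(π (T 1))} :=
      Algebra.subset_adjoin (by simp)
    have h2 : π (T (-1)) ∈ Algebra.adjoin K {π (T 1), ⅟(π (T 1))} :=
      Algebra.subset_adjoin (Or.inr rfl)
    induction q using LaurentPolynomial.induction_on with
    | h_C a => exact (π.commutes a) ▸ Subalgebra.algebraMap_mem _ a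
    | h_add hp hq => rw [map_add]; exact add_mem hp hq
    | h_C_mul_T n a h =>
      rw [T_add, ← mul_assoc, map_mul]
      exact mul_mem h h1
    | h_C_mul_T_Z n a h =>
      rw [sub_eq_add_neg, T_add, ← mul_assoc, map_mul]
      exact mul_mem h h2
  rw [htop] at hfin
  exact Module.Finite.equiv (Subalgebra.topEquiv (R := K)).toLinearEquiv

theorem tIdeal_generator_ne_zero {N : ℕ} (hN : N ≠ 0) :
    (T 1 : LaurentPolynomial K) ^ N - 1 ≠ 0 := by
  rw [T_pow, sub_ne_zero, ← T_zero]
  intro h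
  have := AddMonoidAlgebra.of_injective (R := K) (M := ℤ)
    (a₁ := Multiplicative.ofAdd (N * 1 : ℤ)) (a₂ := Multiplicative.ofAdd 0) h
  simp at this
  exact hN this

theorem finite_quotient_tIdeal {N : ℕ} (hN : N ≠ 0) :
    Module.Finite K (LaurentPolynomial K ⧸ tIdeal K N) :=
  finite_quotient_span_singleton (tIdeal_generator_ne_zero hN)

theorem finrank_quotient_tIdeal {N : ℕ} (hN : N ≠ 0) :
    Module.finrank K (LaurentPolynomial K ⧸ tIdeal K N) = N := by
  have := finite_quotient_tIdeal (K := K) hN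
  have : NeZero N := ⟨hN⟩
  apply le_antisymm
  · have hspan : Submodule.span K (Set.range fun i : Fin N =>
        Ideal.Quotient.mkₐ K (tIdeal K N) (T (i : ℤ))) = ⊤ := by
      rw [eq_top_iff]
      rintro y -
      obtain ⟨q, rfl⟩ := Ideal.Quotient.mkₐ_surjective K _ y
      induction q using LaurentPolynomial.induction_on' with
      | add p q hp hq => rw [map_add]; exact add_mem hp hq
      | C_mul_T n a =>
        rw [← smul_eq_C_mul, map_smul]
        refine Submodule.smul_mem _ _ (Submodule.subset_span ?_)
        refine ⟨⟨(n % N).toNat, ?_⟩, ?_⟩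
        · have := Int.emod_lt_of_pos n (b := N) (by omega)
          omega
        · have h1 : Ideal.Quotient.mkₐ K (tIdeal K N) (T 1 ^ N) = 1 := by
            rw [← map_one (Ideal.Quotient.mkₐ K (tIdeal K N))]
            exact Ideal.Quotient.eq.2 (Ideal.mem_span_singleton_self _)
          have hunit : ∀ k : ℤ, Ideal.Quotient.mkₐ K (tIdeal K N) (T (N * k)) = 1 := by
            rw [T_pow, mul_one] at h1
            intro k
            induction k using Int.induction_on with
            | zero => simp
            | succ k ih => rw [mul_add, T_add, map_mul, ih, mul_one, h1, mul_one]
            | pred k ih =>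
              rw [← ih]
              conv_rhs => rw [show (N : ℤ) * (-k) = N * (-k - 1) + N by ring, T_add, map_mul, h1, mul_one]
          simp only
          rw [Int.toNat_of_nonneg (Int.emod_nonneg _ (by omega))]
          conv_rhs => rw [← Int.emod_add_mul_ediv n N, T_add, map_mul, hunit, mul_one]
    have := finrank_range_le_card (R := K) (fun i : Fin N =>
        Ideal.Quotient.mkₐ K (tIdeal K N) (T (i : ℤ)))
    rw [Set.finrank, hspan, finrank_top] at this
    simpa using this
  · let φ : LaurentPolynomial K →ₐ[K] AddMonoidAlgebra K (ZMod N) :=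
      AddMonoidAlgebra.mapDomainAlgHom K K (Int.castAddHom (ZMod N))
    have hφ : ∀ x ∈ tIdeal K N, φ x = 0 := by
      intro x hx
      have : tIdeal K N ≤ RingHom.ker φ := by
        rw [tIdeal, Ideal.span_singleton_le_iff_mem, RingHom.mem_ker, map_sub, T_pow, map_one,
          sub_eq_zero]
        change AddMonoidAlgebra.mapDomain _ (AddMonoidAlgebra.single _ _) = _
        rw [AddMonoidAlgebra.mapDomain_single]
        simp [AddMonoidAlgebra.one_def]
      exact this hx
    have hsurj : Function.Surjective (Ideal.Quotient.liftₐ (tIdeal K N) φ hφ) := by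
      apply Ideal.Quotient.lift_surjective_of_surjective
      intro x
      induction x using AddMonoidAlgebra.induction_linear with
      | zero => exact ⟨0, map_zero φ⟩
      | add x y hx hy =>
        obtain ⟨x, rfl⟩ := hx
        obtain ⟨y, rfl⟩ := hy
        exact ⟨x + y, map_add φ x y⟩
      | single n a =>
        obtain ⟨n, rfl⟩ := ZMod.intCast_surjective n
        exact ⟨AddMonoidAlgebra.single n a, AddMonoidAlgebra.mapDomain_single⟩
    have h := LinearMap.finrank_le_finrank_of_surjective
      (f := (Ideal.Quotient.liftₐ (tIdeal K N) φ hφ).toLinearMap) hsurj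
    have h2 : Module.finrank K (AddMonoidAlgebra K (ZMod N)) = N := by
      rw [Module.finrank_eq_card_basis (AddMonoidAlgebra.basis (ZMod N) K)]
      simp
    omega

end Finiteness

section Ranks

open Matrix

theorem map_smul_one {R S n : Type} [CommRing R] [CommRing S] [DecidableEq n] (φ : R →+* S)
    (d : R) : (d • (1 : Matrix n n R)).map φ = φ d • (1 : Matrix n n S) := by
  rw [Matrix.map_smul' _ _ _ (map_mul φ), Matrix.map_one _ (map_zero φ) (map_one φ)]

theorem finrank_ker_mulLeft_le {K R : Type} [Field K] [CommRing R] [Algebra K R] (I : Ideal R)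
    [Module.Finite K (R ⧸ I)] (d : R) [Module.Finite K (R ⧸ Ideal.span {d})] :
    Module.finrank K (LinearMap.ker (LinearMap.mulLeft K (Ideal.Quotient.mk I d))) ≤
      Module.finrank K (R ⧸ Ideal.span {d}) := by
  let δ := LinearMap.mulLeft K (Ideal.Quotient.mk I d)
  have h1 := LinearMap.finrank_range_add_finrank_ker δ
  have h2 := Submodule.finrank_quotient_add_finrank (LinearMap.range δ)
  let ψ : R →ₗ[K] (R ⧸ I) ⧸ LinearMap.range δ :=
    (LinearMap.range δ).mkQ ∘ₗ (Ideal.Quotient.mkₐ K I).toLinearMap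
  have hψ : (Ideal.span {d}).restrictScalars K ≤ LinearMap.ker ψ := by
    intro x hx
    obtain ⟨y, rfl⟩ := Ideal.mem_span_singleton'.1 hx
    rw [LinearMap.mem_ker]
    refine (Submodule.Quotient.mk_eq_zero _).2 ⟨Ideal.Quotient.mk I y, ?_⟩
    simp [δ, mul_comm]
  have : Module.Finite K (R ⧸ (Ideal.span {d}).restrictScalars K) :=
    inferInstanceAs (Module.Finite K (R ⧸ Ideal.span {d}))
  have h3 := LinearMap.finrank_le_finrank_of_surjective
    (f := ((Ideal.span {d}).restrictScalars K).liftQ ψ hψ) (by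
      rw [← LinearMap.range_eq_top, Submodule.range_liftQ, LinearMap.range_eq_top]
      exact (Submodule.mkQ_surjective _).comp (Ideal.Quotient.mkₐ_surjective K I))
  have h4 : Module.finrank K (R ⧸ (Ideal.span {d}).restrictScalars K) =
    Module.finrank K (R ⧸ Ideal.span {d}) := rfl
  change Module.finrank K (LinearMap.ker δ) ≤ _
  omega

theorem finrank_le_finrank_range_of_mul_eq_smul_one {K Q : Type} [Field K] [CommRing Q]
    [Algebra K Q] [Module.Finite K Q] {m s : ℕ} (M : Matrix (Fin m) (Fin s) Q)
    (X : Matrix (Fin s) (Fin m) Q) (δ : Q) (h : X * M = δ • (1 : Matrix (Fin s) (Fin s) Q)) :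
    s * Module.finrank K Q ≤ Module.finrank K (LinearMap.range (M.mulVecLin.restrictScalars K)) +
      s * Module.finrank K (LinearMap.ker (LinearMap.mulLeft K δ)) := by
  have h1 := LinearMap.finrank_range_add_finrank_ker (M.mulVecLin.restrictScalars K)
  rw [Module.finrank_pi_fintype] at h1
  have key : ∀ v ∈ LinearMap.ker (M.mulVecLin.restrictScalars K), ∀ i,
      v i ∈ LinearMap.ker (LinearMap.mulLeft K δ) := by
    intro v hv i
    have hv' : M *ᵥ v = 0 := hv
    have : (X * M) *ᵥ v = 0 := by rw [← Matrix.mulVec_mulVec, hv', Matrix.mulVec_zero]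
    rw [h, Matrix.smul_mulVec, Matrix.one_mulVec] at this
    exact congrFun this i
  let φ : LinearMap.ker (M.mulVecLin.restrictScalars K) →ₗ[K]
      (Fin s → LinearMap.ker (LinearMap.mulLeft K δ)) :=
    LinearMap.pi fun i => ((LinearMap.proj i).comp
      (LinearMap.ker (M.mulVecLin.restrictScalars K)).subtype).codRestrict _
        fun v => key v v.2 i
  have hφ : Function.Injective φ := by
    intro v w hvw
    ext i
    exact congrArg Subtype.val (congrFun hvw i)
  have h2 := LinearMap.finrank_le_finrank_of_injective hφ
  rw [Module.finrank_pi_fintype] at h2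
  simp at h1 h2
  omega

theorem exists_mul_eq_smul_one {R : Type} [CommRing R] [IsDomain R] {m s : ℕ}
    (M : Matrix (Fin m) (Fin s) R) (hM : LinearIndependent R M.col) :
    ∃ (X : Matrix (Fin s) (Fin m) R) (d : R), d ≠ 0 ∧
      X * M = d • (1 : Matrix (Fin s) (Fin s) R) := by
  let k := FractionRing R
  let M' : Matrix (Fin m) (Fin s) k := M.map (algebraMap R k)
  have hM' : LinearIndependent k M'.col := by
    rw [← LinearIndependent.iff_fractionRing (R := R)]
    let L : (Fin m → R) →ₗ[R] (Fin m → k) := (Algebra.linearMap R k).compLeft (Fin m)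
    have hL : LinearMap.ker L = ⊥ := by
      rw [LinearMap.ker_eq_bot]
      intro v w hvw
      ext i
      exact IsFractionRing.injective R k (congrFun hvw i)
    exact hM.map' L hL
  obtain ⟨g, hg⟩ := LinearMap.exists_leftInverse_of_injective M'.mulVecLin
    (LinearMap.ker_eq_bot.2 (Matrix.mulVec_injective_iff.2 hM'))
  let Y := LinearMap.toMatrix' g
  have hY : Y * M' = 1 := by
    have := congrArg LinearMap.toMatrix' hg
    rwa [LinearMap.toMatrix'_comp, LinearMap.toMatrix'_id, ← Matrix.toLin'_apply',
      LinearMap.toMatrix'_toLin'] at this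
  obtain ⟨d, hd⟩ := IsLocalization.exist_integer_multiples_of_finite (nonZeroDivisors R)
    (fun p : Fin s × Fin m => Y p.1 p.2)
  choose X hX using hd
  refine ⟨Matrix.of fun i j => X (i, j), d, nonZeroDivisors.coe_ne_zero d, ?_⟩
  apply Matrix.map_injective (IsFractionRing.injective R k)
  have hX' : (Matrix.of fun i j => X (i, j)).map (algebraMap R k) = (d : R) • Y := by
    ext i j
    exact hX (i, j)
  beta_reduce
  rw [Matrix.map_mul, hX']
  change ((d : R) • Y) * M' = _
  rw [Matrix.smul_mul, hY, map_smul_one, algebraMap_smul]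

end Ranks

section Asymptotics

open Matrix

variable {K : Type} [Field K]

/-- The `K`-linear map over `R_N = R ⧸ (t^N - 1)` induced by a matrix over `R = K[t,t⁻¹]`. -/
noncomputable abbrev mulVecLinModN {a b : ℕ} (N : ℕ)
    (F : Matrix (Fin a) (Fin b) (LaurentPolynomial K)) :
    (Fin b → LaurentPolynomial K ⧸ tIdeal K N) →ₗ[K] (Fin a → LaurentPolynomial K ⧸ tIdeal K N) :=
  (Matrix.mulVecLin (F.map (Ideal.Quotient.mk (tIdeal K N)))).restrictScalars K

theorem mulVecLinModN_mul {a b c : ℕ} (N : ℕ) (F : Matrix (Fin a) (Fin b) (LaurentPolynomial K))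
    (G : Matrix (Fin b) (Fin c) (LaurentPolynomial K)) :
    mulVecLinModN N (F * G) = mulVecLinModN N F ∘ₗ mulVecLinModN N G := by
  rw [mulVecLinModN, Matrix.map_mul, Matrix.mulVecLin_mul]
  rfl

theorem range_mulVecLinModN_le_ker {a b c : ℕ} (N : ℕ)
    {F : Matrix (Fin a) (Fin b) (LaurentPolynomial K)}
    {G : Matrix (Fin b) (Fin c) (LaurentPolynomial K)} (hFG : F * G = 0) :
    LinearMap.range (mulVecLinModN N G) ≤ LinearMap.ker (mulVecLinModN N F) := by
  rw [LinearMap.range_le_ker_iff, ← mulVecLinModN_mul, hFG]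
  rw [mulVecLinModN, Matrix.map_zero _ (map_zero _), Matrix.mulVecLin_zero]
  rfl

theorem finrank_range_add_finrank_ker_mulVecLinModN {a b N : ℕ} (hN : N ≠ 0)
    (F : Matrix (Fin a) (Fin b) (LaurentPolynomial K)) :
    Module.finrank K (LinearMap.range (mulVecLinModN N F)) +
      Module.finrank K (LinearMap.ker (mulVecLinModN N F)) = b * N := by
  have := finite_quotient_tIdeal (K := K) hN
  rw [LinearMap.finrank_range_add_finrank_ker, Module.finrank_pi_fintype]
  simp [finrank_quotient_tIdeal hN]

theorem finrank_range_add_finrank_ker_mulVecLin {a b : ℕ}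
    (F : Matrix (Fin a) (Fin b) (LaurentPolynomial K)) :
    Module.finrank (LaurentPolynomial K) (LinearMap.range F.mulVecLin) +
      Module.finrank (LaurentPolynomial K) (LinearMap.ker F.mulVecLin) = b := by
  have h := Submodule.finrank_quotient_add_finrank (LinearMap.ker F.mulVecLin)
  rw [F.mulVecLin.quotKerEquivRange.finrank_eq] at h
  simpa using h

theorem exists_card_mul_le_finrank_range {m s : ℕ}
    (M : Matrix (Fin m) (Fin s) (LaurentPolynomial K))
    (hM : LinearIndependent (LaurentPolynomial K) M.col) :
    ∃ C : ℕ, ∀ N : ℕ, N ≠ 0 →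
      s * N ≤ Module.finrank K (LinearMap.range (mulVecLinModN N M)) + C := by
  obtain ⟨X, d, hd, h⟩ := exists_mul_eq_smul_one M hM
  have := finite_quotient_span_singleton hd
  refine ⟨s * Module.finrank K (LaurentPolynomial K ⧸ Ideal.span {d}), fun N hN => ?_⟩
  have := finite_quotient_tIdeal (K := K) hN
  have h1 := finrank_le_finrank_range_of_mul_eq_smul_one (K := K)
    (M.map (Ideal.Quotient.mk (tIdeal K N))) (X.map (Ideal.Quotient.mk (tIdeal K N)))
    (Ideal.Quotient.mk (tIdeal K N) d) (by
      rw [← Matrix.map_mul, h, map_smul_one])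
  rw [finrank_quotient_tIdeal hN] at h1
  exact h1.trans (Nat.add_le_add_left
    (Nat.mul_le_mul_left s (finrank_ker_mulLeft_le (tIdeal K N) d)) _)

theorem exists_finrank_mul_le_finrank_range {a b : ℕ}
    (F : Matrix (Fin a) (Fin b) (LaurentPolynomial K)) :
    ∃ C : ℕ, ∀ N : ℕ, N ≠ 0 →
      Module.finrank (LaurentPolynomial K) (LinearMap.range F.mulVecLin) * N ≤
        Module.finrank K (LinearMap.range (mulVecLinModN N F)) + C := by
  obtain ⟨f, hf⟩ := exists_linearIndependent_of_le_finrank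
    (le_refl (Module.finrank (LaurentPolynomial K) (LinearMap.range F.mulVecLin)))
  choose v hv using fun i => (f i).2
  let Y : Matrix (Fin b) (Fin _) (LaurentPolynomial K) := Matrix.of fun j i => v i j
  have hFY : (F * Y).col = fun i => (f i : Fin a → LaurentPolynomial K) := by
    funext i
    rw [← hv i]
    rfl
  obtain ⟨C, hC⟩ := exists_card_mul_le_finrank_range (F * Y) (by
    rw [hFY]
    exact hf.map' (LinearMap.range F.mulVecLin).subtype (Submodule.ker_subtype _))
  refine ⟨C, fun N hN => (hC N hN).trans (Nat.add_le_add_right ?_ C)⟩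
  have := finite_quotient_tIdeal (K := K) hN
  rw [mulVecLinModN_mul]
  exact Submodule.finrank_mono (LinearMap.range_comp_le_range _ _)

theorem exists_finrank_range_le_finrank_mul {a b : ℕ}
    (F : Matrix (Fin a) (Fin b) (LaurentPolynomial K)) :
    ∃ C : ℕ, ∀ N : ℕ, N ≠ 0 →
      Module.finrank K (LinearMap.range (mulVecLinModN N F)) ≤
        Module.finrank (LaurentPolynomial K) (LinearMap.range F.mulVecLin) * N + C := by
  obtain ⟨f, hf⟩ := exists_linearIndependent_of_le_finrank
    (le_refl (Module.finrank (LaurentPolynomial K) (LinearMap.ker F.mulVecLin)))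
  let Z : Matrix (Fin b) (Fin _) (LaurentPolynomial K) :=
    Matrix.of fun j i => (f i : Fin b → LaurentPolynomial K) j
  have hFZ : F * Z = 0 := by
    refine Matrix.ext fun j i => ?_
    exact congrFun (f i).2 j
  obtain ⟨C, hC⟩ := exists_card_mul_le_finrank_range Z
    (hf.map' (LinearMap.ker F.mulVecLin).subtype (Submodule.ker_subtype _))
  refine ⟨C, fun N hN => ?_⟩
  have := finite_quotient_tIdeal (K := K) hN
  have h1 := hC N hN
  have h2 := Submodule.finrank_mono (range_mulVecLinModN_le_ker N hFZ)
  have h3 := finrank_range_add_finrank_ker_mulVecLinModN hN F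
  have h4 := congrArg (· * N) (finrank_range_add_finrank_ker_mulVecLin F)
  simp only [add_mul] at h4
  omega

theorem finrank_laurentHomology {a b c : ℕ}
    {F : Matrix (Fin a) (Fin b) (LaurentPolynomial K)}
    {G : Matrix (Fin b) (Fin c) (LaurentPolynomial K)} (hFG : F * G = 0) :
    Module.finrank (LaurentPolynomial K) (laurentHomology F G) +
      Module.finrank (LaurentPolynomial K) (LinearMap.range F.mulVecLin) +
      Module.finrank (LaurentPolynomial K) (LinearMap.range G.mulVecLin) = b := by
  have : IsNoetherianRing (LaurentPolynomial K) :=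
    IsLocalization.isNoetherianRing (Submonoid.powers (Polynomial.X : Polynomial K)) _ inferInstance
  have hle : LinearMap.range G.mulVecLin ≤ LinearMap.ker F.mulVecLin := by
    rw [LinearMap.range_le_ker_iff, ← Matrix.mulVecLin_mul, hFG, Matrix.mulVecLin_zero]
  have h1 : Module.finrank (LaurentPolynomial K) (laurentHomology F G) + _ = _ :=
    Submodule.finrank_quotient_add_finrank
      ((LinearMap.range G.mulVecLin).comap (LinearMap.ker F.mulVecLin).subtype)
  rw [(Submodule.comapSubtypeEquivOfLe hle).finrank_eq] at h1
  have h2 := finrank_range_add_finrank_ker_mulVecLin F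
  omega

theorem finrank_laurentHomologyModN {a b c N : ℕ} (hN : N ≠ 0)
    {F : Matrix (Fin a) (Fin b) (LaurentPolynomial K)}
    {G : Matrix (Fin b) (Fin c) (LaurentPolynomial K)} (hFG : F * G = 0) :
    Module.finrank K (laurentHomologyModN N F G) +
      Module.finrank K (LinearMap.range (mulVecLinModN N F)) +
      Module.finrank K (LinearMap.range (mulVecLinModN N G)) = b * N := by
  have := finite_quotient_tIdeal (K := K) hN
  have h1 : Module.finrank K (laurentHomologyModN N F G) + _ = _ :=
    Submodule.finrank_quotient_add_finrank
      ((LinearMap.range (mulVecLinModN N G)).comap (LinearMap.ker (mulVecLinModN N F)).subtype)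
  rw [(Submodule.comapSubtypeEquivOfLe (range_mulVecLinModN_le_ker N hFG)).finrank_eq] at h1
  have h2 := finrank_range_add_finrank_ker_mulVecLinModN hN F
  omega

theorem tendsto_div_of_abs_sub_le {u : ℕ → ℕ} {r C : ℕ}
    (h₁ : ∀ N, N ≠ 0 → u N ≤ r * N + C) (h₂ : ∀ N, N ≠ 0 → r * N ≤ u N + C) :
    Filter.Tendsto (fun N : ℕ => (u N : ℝ) / N) Filter.atTop (nhds (r : ℝ)) := by
  rw [tendsto_iff_dist_tendsto_zero]
  refine squeeze_zero' (Filter.Eventually.of_forall fun _ => dist_nonneg) ?_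
    (tendsto_const_div_atTop_nhds_zero_nat (C : ℝ))
  filter_upwards [Filter.eventually_ne_atTop 0] with N hN
  have hpos : (0 : ℝ) < N := by positivity
  have h1 : (u N : ℝ) ≤ r * N + C := by exact_mod_cast h₁ N hN
  have h2 : (r * N : ℝ) ≤ u N + C := by exact_mod_cast h₂ N hN
  rw [Real.dist_eq, div_sub' hpos.ne', abs_div, abs_of_pos hpos]
  gcongr
  rw [abs_le]
  constructor <;> linarith

end Asymptotics

/-- let `K` be an algebraically closed field, `R = K[t,t⁻¹]`,
`g : R^c → R^b` and `f : R^b → R^a` maps given by matrices `F, G` with `F * G = 0`,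
and `H = ker f / im g`.  With `H_N` the homology of the induced complex over
`R_N = R/(t^N - 1)`, the limit of `dim_K H_N / N` as `N → ∞` exists and equals the
rank of `H` over `R`, i.e. `dim_{K(t)} (K(t) ⊗[R] H)`. -/
theorem stmt12 (K : Type) [Field K] [IsAlgClosed K] (a b c : ℕ)
    (F : Matrix (Fin a) (Fin b) (LaurentPolynomial K))
    (G : Matrix (Fin b) (Fin c) (LaurentPolynomial K))
    (hFG : F * G = 0) :
    Filter.Tendsto
      (fun N : ℕ => (Module.finrank K (laurentHomologyModN N F G) : ℝ) / N)
      Filter.atTop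
      (nhds (Module.finrank (FractionRing (LaurentPolynomial K))
        (FractionRing (LaurentPolynomial K) ⊗[LaurentPolynomial K]
          laurentHomology F G) : ℝ)) := by
  have hbase : Module.finrank (FractionRing (LaurentPolynomial K))
      (FractionRing (LaurentPolynomial K) ⊗[LaurentPolynomial K] laurentHomology F G) =
      Module.finrank (LaurentPolynomial K) (laurentHomology F G) :=
    (TensorProduct.isBaseChange (LaurentPolynomial K) (laurentHomology F G)
      (FractionRing (LaurentPolynomial K))).finrank_eq
  rw [hbase]
  obtain ⟨C₁, h₁⟩ := exists_finrank_mul_le_finrank_range F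
  obtain ⟨C₂, h₂⟩ := exists_finrank_mul_le_finrank_range G
  obtain ⟨C₃, h₃⟩ := exists_finrank_range_le_finrank_mul F
  obtain ⟨C₄, h₄⟩ := exists_finrank_range_le_finrank_mul G
  have hrank (N : ℕ) := congrArg (· * N) (finrank_laurentHomology hFG)
  simp only [add_mul] at hrank
  refine tendsto_div_of_abs_sub_le (C := C₁ + C₂ + C₃ + C₄) (fun N hN => ?_) fun N hN => ?_
  all_goals
    have := h₁ N hN
    have := h₂ N hN
    have := h₃ N hN
    have := h₄ N hN
    have := hrank N
    have := finrank_laurentHomologyModN hN hFG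
    omega
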